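/- Let τ : [0,∞) → [0,∞) be Borel measurable with ∫₀^∞ e^{ar} τ(r) dr < ∞ for every a > 0, and for a positive integer D define v_τ(ζ, D) = π^{D/2} ∫₀^∞ w_D(ζ, r) τ(r) dr. Suppose that for some D the function v_τ(·, D) is a Laguerre entire function of the first kind, i.e. v_τ(ζ, D) = C ζ^k e^{αζ} ∏_{j=1}^∞ (1 + γ_j ζ) with C > 0, k a nonnegative integer, α ≥ 0, and (γ_j) a summable sequence of nonnegative reals. Then for every nonnegative integer m, the function v_τ(·, D + 2m) admits a representation of the same form: v_τ(ζ, D+2m) = C' ζ^{k'} e^{α'ζ} ∏_{j=1}^∞ (1 + γ'_j ζ) with C' > 0, k' ∈ ℕ₀, α' ≥ 0, and (γ'_j) summable nonnegative. -/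

import Mathlib

open MeasureTheory

noncomputable section

/-- The kernel `w_D(ζ, r) = Σ_{n≥0} ζⁿ r^{D/2+n−1} / (4ⁿ n! Γ(D/2+n))`. -/
def wD (D : ℕ) (ζ : ℂ) (r : ℝ) : ℂ :=
  ∑' n : ℕ, ζ ^ n *
    ((r ^ ((D : ℝ) / 2 + n - 1) / (4 ^ n * n.factorial * Real.Gamma ((D : ℝ) / 2 + n)) : ℝ) : ℂ)

/-- `v_τ(ζ, D) = π^{D/2} ∫₀^∞ w_D(ζ, r) τ(r) dr`. -/
def vtau (τ : ℝ → ℝ) (D : ℕ) (ζ : ℂ) : ℂ :=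
  ((Real.pi ^ ((D : ℝ) / 2) : ℝ) : ℂ) *
    ∫ r in Set.Ioi (0 : ℝ), wD D ζ r * ((τ r : ℝ) : ℂ)

/-- A Laguerre entire function of the first kind with a positive leading constant:
`h(ζ) = C ζ^k e^{αζ} ∏_j (1 + γ_j ζ)` with `C > 0`, `k ∈ ℕ₀`, `α ≥ 0`, `γ_j ≥ 0`
summable. -/
def LaguerreForm (h : ℂ → ℂ) : Prop :=
  ∃ (C : ℝ) (k : ℕ) (α : ℝ) (γ : ℕ → ℝ),
    0 < C ∧ 0 ≤ α ∧ (∀ j, 0 ≤ γ j) ∧ Summable γ ∧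
    ∀ ζ : ℂ, h ζ = (C : ℂ) * ζ ^ k * Complex.exp ((α : ℂ) * ζ) *
      ∏' j, (1 + (γ j : ℂ) * ζ)

open Filter Topology Polynomial

theorem Polynomial.Splits.derivative_of_real {p : ℝ[X]} (hp : p.Splits) :
    (derivative p).Splits := by
  rcases Nat.eq_zero_or_pos p.natDegree with h | h
  · rw [natDegree_eq_zero] at h
    obtain ⟨c, rfl⟩ := h
    simp
  · rw [splits_iff_card_roots] at hp ⊢
    have h1 := card_roots_le_derivative p
    have h2 := card_roots' (derivative p)
    have h3 := natDegree_derivative_lt h.ne'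
    omega

theorem coeff_mul_nonneg {p q : ℝ[X]} (hp : ∀ i, 0 ≤ p.coeff i) (hq : ∀ i, 0 ≤ q.coeff i)
    (i : ℕ) : 0 ≤ (p * q).coeff i := by
  rw [coeff_mul]
  exact Finset.sum_nonneg fun x _ => mul_nonneg (hp _) (hq _)

theorem coeff_prod_nonneg {ι : Type*} (s : Finset ι) {f : ι → ℝ[X]}
    (hf : ∀ j ∈ s, ∀ i, 0 ≤ (f j).coeff i) : ∀ i, 0 ≤ (∏ j ∈ s, f j).coeff i := by
  refine Finset.prod_induction f (fun p => ∀ i, 0 ≤ p.coeff i)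
    (fun p q hp hq => coeff_mul_nonneg hp hq) (fun i => ?_) hf
  rw [coeff_one]
  split_ifs <;> simp

theorem coeff_one_add_C_mul_X_nonneg {a : ℝ} (ha : 0 ≤ a) (i : ℕ) :
    0 ≤ (1 + C a * X : ℝ[X]).coeff i := by
  rw [coeff_add, coeff_one, coeff_C_mul, coeff_X]
  split_ifs <;> simp <;> linarith

theorem splits_one_add_C_mul_X (a : ℝ) : (1 + C a * X : ℝ[X]).Splits := by
  refine Splits.of_natDegree_le_one ?_
  compute_degree

theorem coeff_derivative_nonneg {p : ℝ[X]} (hp : ∀ i, 0 ≤ p.coeff i) (i : ℕ) :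
    0 ≤ (derivative p).coeff i := by
  rw [coeff_derivative]
  exact mul_nonneg (hp _) (by positivity)

theorem eval_zero_le_eval_of_coeff_nonneg {p : ℝ[X]} (hp : ∀ i, 0 ≤ p.coeff i) {x : ℝ}
    (hx : 0 ≤ x) : p.eval 0 ≤ p.eval x := by
  rw [← coeff_zero_eq_eval_zero, eval_eq_sum_range]
  calc p.coeff 0 = p.coeff 0 * x ^ 0 := by simp
    _ ≤ _ := Finset.single_le_sum (f := fun i => p.coeff i * x ^ i)
      (fun i _ => mul_nonneg (hp i) (pow_nonneg hx i)) (by simp)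

/-- A split real polynomial with nonnegative coefficients and positive constant term factors as
`p(0) ∏ (1 + γ_j z)` with `γ` nonnegative and decreasing. -/
theorem exists_antitone_factorization {p : ℝ[X]} (hs : p.Splits) (hp : ∀ i, 0 ≤ p.coeff i)
    (h0 : 0 < p.eval 0) :
    ∃ (γ : ℕ → ℝ) (N : ℕ), Antitone γ ∧ (∀ j, 0 ≤ γ j) ∧ (∀ j, N ≤ j → γ j = 0) ∧
      ∀ z : ℂ, aeval z p = ((p.eval 0 : ℝ) : ℂ) * ∏ j ∈ Finset.range N, (1 + (γ j : ℂ) * z) := by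
  have hroot : ∀ a ∈ p.roots, a < 0 := by
    intro a ha
    by_contra! h
    have h1 := eval_zero_le_eval_of_coeff_nonneg hp h
    rw [(mem_roots'.1 ha).2.eq_zero] at h1
    linarith
  set l : List ℝ := (p.roots.map fun a => -a⁻¹).sort (· ≥ ·) with hl
  have hlm : (l : Multiset ℝ) = p.roots.map fun a => -a⁻¹ := Multiset.sort_eq _ _
  have hlpos : ∀ x ∈ l, 0 ≤ x := by
    intro x hx
    have hx' : x ∈ (l : Multiset ℝ) := hx
    rw [hlm, Multiset.mem_map] at hx'
    obtain ⟨a, ha, rfl⟩ := hx'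
    have := inv_lt_zero.2 (hroot a ha)
    linarith
  have hget : ∀ j, 0 ≤ l.getD j 0 := by
    intro j
    by_cases hj : j < l.length
    · rw [List.getD_eq_getElem _ _ hj]
      exact hlpos _ (List.getElem_mem hj)
    · rw [List.getD_eq_default _ _ (not_lt.1 hj)]
  refine ⟨fun j => l.getD j 0, l.length, ?_, hget, fun j hj => List.getD_eq_default _ _ hj, ?_⟩
  · intro i j hij
    by_cases hj : j < l.length
    · have hi := hij.trans_lt hj
      simp only [List.getD_eq_getElem _ _ hj, List.getD_eq_getElem _ _ hi]
      rcases hij.eq_or_lt with rfl | hlt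
      · rfl
      · exact List.pairwise_iff_getElem.1 (Multiset.pairwise_sort (p.roots.map fun a => -a⁻¹)
          (· ≥ ·)) i j hi hj hlt
    · simp only [List.getD_eq_default _ _ (not_lt.1 hj)]
      exact hget i
  · intro z
    have e1 : ∀ z : ℂ, aeval z p = (p.leadingCoeff : ℂ) *
        (p.roots.map fun a : ℝ => z - (a : ℂ)).prod := by
      intro z
      conv_lhs => rw [hs.eq_prod_roots]
      rw [map_mul, map_multiset_prod, Multiset.map_map]
      simp
    have e2 : (p.roots.map fun a : ℝ => z - (a : ℂ)).prod =
        (p.roots.map fun a : ℝ => (0 : ℂ) - (a : ℂ)).prod *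
          (p.roots.map fun a : ℝ => 1 + ((-a⁻¹ : ℝ) : ℂ) * z).prod := by
      rw [← Multiset.prod_map_mul]
      congr 1
      refine Multiset.map_congr rfl fun a ha => ?_
      have : (a : ℂ) ≠ 0 := by exact_mod_cast (hroot a ha).ne
      push_cast
      field_simp
      ring
    have e3 : ((p.eval 0 : ℝ) : ℂ) = aeval (0 : ℂ) p := by
      have := aeval_algebraMap_apply ℂ (0 : ℝ) p
      simpa using this.symm
    have e4 : (p.roots.map fun a : ℝ => 1 + ((-a⁻¹ : ℝ) : ℂ) * z).prod =
        ∏ j ∈ Finset.range l.length, (1 + ((l.getD j 0 : ℝ) : ℂ) * z) := by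
      have : (p.roots.map fun a : ℝ => 1 + ((-a⁻¹ : ℝ) : ℂ) * z) =
          (p.roots.map fun a => -a⁻¹).map fun x : ℝ => 1 + (x : ℂ) * z := by
        rw [Multiset.map_map]; rfl
      rw [this, ← hlm, Multiset.map_coe, Multiset.prod_coe, Finset.prod_range,
        ← Fin.prod_univ_fun_getElem]
      refine Finset.prod_congr rfl fun j _ => ?_
      simp
    rw [e3, e1 z, e1 0, e2, e4, mul_assoc]

theorem one_add_sum_le_prod_one_add_of_nonneg (s : Finset ℕ) {γ : ℕ → ℝ} (hγ : ∀ j, 0 ≤ γ j) :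
    1 + ∑ j ∈ s, γ j ≤ ∏ j ∈ s, (1 + γ j) := by
  induction s using Finset.cons_induction with
  | empty => simp
  | cons a s ha ih =>
    rw [Finset.sum_cons, Finset.prod_cons]
    nlinarith [hγ a, mul_nonneg (hγ a) (Finset.sum_nonneg fun j (_ : j ∈ s) => hγ j)]

theorem norm_one_add_mul_exp_neg_sub_one_le (x : ℂ) :
    ‖(1 + x) * Complex.exp (-x) - 1‖ ≤ ‖x‖ ^ 2 * Real.exp (2 * ‖x‖) := by
  have h1 := Complex.norm_exp_sub_sum_le_norm_mul_exp x 2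
  have h2 := Complex.norm_exp_le_exp_norm (-x)
  have e : (1 + x) * Complex.exp (-x) - 1 =
      -((Complex.exp x - ∑ m ∈ Finset.range 2, x ^ m / m.factorial) * Complex.exp (-x)) := by
    have : Complex.exp x * Complex.exp (-x) = 1 := by rw [← Complex.exp_add]; simp
    simp only [Finset.sum_range_succ, Finset.sum_range_zero]
    simp only [pow_zero, Nat.factorial, Nat.cast_one, pow_one]
    linear_combination this
  rw [norm_neg] at h2
  rw [e, norm_neg, norm_mul, two_mul, Real.exp_add, ← mul_assoc]
  exact mul_le_mul h1 h2 (norm_nonneg _) (by positivity)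

theorem tprod_one_add_mul_exp_neg {γ : ℕ → ℝ} (hγ : ∀ j, 0 ≤ γ j) (hs : Summable γ) (z : ℂ) :
    ∏' j, (1 + ((1 + (γ j : ℂ) * z) * Complex.exp (-((γ j : ℂ) * z)) - 1)) =
      (∏' j, (1 + (γ j : ℂ) * z)) * Complex.exp (-(((∑' j, γ j : ℝ) : ℂ) * z)) := by
  have hm : Multipliable fun j => 1 + (γ j : ℂ) * z := by
    refine multipliable_one_add_of_summable ?_
    simpa [abs_of_nonneg (hγ _)] using hs.mul_right ‖z‖
  have he : HasProd (fun j => Complex.exp (-((γ j : ℂ) * z)))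
      (Complex.exp (-(((∑' j, γ j : ℝ) : ℂ) * z))) :=
    HasSum.cexp (((Complex.hasSum_ofReal.2 hs.hasSum).mul_right z).neg)
  rw [← (hm.hasProd.mul he).tprod_eq]
  exact tprod_congr fun j => by ring

/-- A sequence of split real polynomials with nonnegative coefficients that converges pointwise on
`ℂ`, with positive limit at `0`, converges to a Laguerre entire function of the first kind. -/
theorem laguerreForm_of_tendsto {q : ℕ → ℝ[X]} (hs : ∀ n, (q n).Splits)
    (hq : ∀ n i, 0 ≤ (q n).coeff i) {c : ℝ} (hc : 0 < c)
    (h0 : Tendsto (fun n => (q n).eval 0) atTop (𝓝 c)) {g : ℂ → ℂ}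
    (hg : ∀ z, Tendsto (fun n => aeval z (q n)) atTop (𝓝 (g z))) : LaguerreForm g := by
  obtain ⟨n₀, hn₀⟩ := eventually_atTop.1 (h0.eventually (lt_mem_nhds (half_lt_self hc)))
  have hpos : ∀ n, c / 2 < (q (n + n₀)).eval 0 := fun n => hn₀ _ (Nat.le_add_left _ _)
  choose γ N hanti hnn hzero hfac using fun n => exists_antitone_factorization (hs (n + n₀))
    (hq (n + n₀)) ((half_pos hc).trans (hpos n))
  replace h0 := h0.comp (tendsto_add_atTop_nat n₀)
  replace hg := fun z => (hg z).comp (tendsto_add_atTop_nat n₀)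
  set S : ℕ → ℝ := fun n => ∑ j ∈ Finset.range (N n), γ n j with hS
  have hSsum : ∀ n (s : Finset ℕ), ∑ j ∈ s, γ n j ≤ S n := by
    intro n s
    calc ∑ j ∈ s, γ n j ≤ ∑ j ∈ s ∪ Finset.range (N n), γ n j :=
          Finset.sum_le_sum_of_subset_of_nonneg Finset.subset_union_left fun j _ _ => hnn n j
      _ = S n := by
          symm
          refine Finset.sum_subset Finset.subset_union_right fun j _ hj => hzero n j ?_
          simpa using hj
  obtain ⟨B, hB⟩ : ∃ B, ∀ n, S n ≤ B := by
    obtain ⟨K, hK⟩ := (hg 1).norm.bddAbove_range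
    refine ⟨K / (c / 2), fun n => ?_⟩
    have h1 := hK ⟨n, rfl⟩
    simp only [Function.comp_apply, hfac n 1, mul_one, norm_mul, Complex.norm_real] at h1
    have h2 : ‖∏ j ∈ Finset.range (N n), (1 + (γ n j : ℂ))‖ =
        ∏ j ∈ Finset.range (N n), (1 + γ n j) := by
      rw [norm_prod]
      refine Finset.prod_congr rfl fun j _ => ?_
      rw [← Complex.ofReal_one, ← Complex.ofReal_add, Complex.norm_real, Real.norm_eq_abs,
        abs_of_nonneg (by linarith [hnn n j])]
    have h3 := one_add_sum_le_prod_one_add_of_nonneg (Finset.range (N n)) (hnn n)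
    rw [h2, Real.norm_eq_abs, abs_of_pos ((half_pos hc).trans (hpos n))] at h1
    rw [le_div_iff₀ (half_pos hc)]
    have h4 : 0 ≤ S n := Finset.sum_nonneg fun j _ => hnn n j
    nlinarith [hpos n]
  have hSnn : ∀ n, 0 ≤ S n := fun n => Finset.sum_nonneg fun j _ => hnn n j
  have hBnn : 0 ≤ B := (hSnn 0).trans (hB 0)
  have hdecay : ∀ n j, γ n j ≤ B / (j + 1 : ℝ) := by
    intro n j
    rw [le_div_iff₀ (by positivity)]
    calc γ n j * (j + 1 : ℝ) = ∑ _i ∈ Finset.range (j + 1), γ n j := by simp [mul_comm]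
      _ ≤ ∑ i ∈ Finset.range (j + 1), γ n i :=
        Finset.sum_le_sum fun i hi => hanti n (Nat.lt_succ_iff.1 (Finset.mem_range.1 hi))
      _ ≤ B := (hSsum n _).trans (hB n)
  have hγB : ∀ n j, γ n j ≤ B := fun n j => by
    simpa using (hSsum n {j}).trans (hB n)
  obtain ⟨⟨T, δ⟩, -, φ, hφ, hlim⟩ :=
    ((isCompact_Icc (a := (0 : ℝ)) (b := B)).prod
      (isCompact_univ_pi fun _ : ℕ => isCompact_Icc (a := (0 : ℝ)) (b := B))).tendsto_subseq
      (x := fun n => (S n, γ n)) fun n => ⟨⟨hSnn n, hB n⟩, fun j _ => ⟨hnn n j, hγB n j⟩⟩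
  rw [Prod.tendsto_iff] at hlim
  obtain ⟨hT, hδ⟩ := hlim
  simp only [Function.comp_def] at hT hδ
  rw [tendsto_pi_nhds] at hδ
  have hδnn : ∀ j, 0 ≤ δ j := fun j => ge_of_tendsto' (hδ j) fun n => hnn _ j
  have hδT : ∀ s : Finset ℕ, ∑ j ∈ s, δ j ≤ T := fun s =>
    le_of_tendsto_of_tendsto' (tendsto_finsetSum s fun j _ => hδ j) hT fun n => hSsum _ s
  have hδs : Summable δ := summable_of_sum_le hδnn hδT
  refine ⟨c, 0, T - ∑' j, δ j, δ, hc, sub_nonneg.2 (hδs.tsum_le_of_sum_le hδT), hδnn, hδs, ?_⟩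
  intro z
  have hprod : Tendsto
      (fun n => ∏' j, (1 + ((1 + (γ (φ n) j : ℂ) * z) * Complex.exp (-((γ (φ n) j : ℂ) * z)) - 1)))
      atTop
      (𝓝 (∏' j, (1 + ((1 + (δ j : ℂ) * z) * Complex.exp (-((δ j : ℂ) * z)) - 1)))) := by
    refine tendsto_tprod_one_add_of_dominated_convergence
      (bound := fun j : ℕ => (B * ‖z‖) ^ 2 * Real.exp (2 * (B * ‖z‖)) * (1 / ((j : ℝ) + 1)) ^ 2)
      ?_ ?_ ?_
    · refine Summable.mul_left _ ?_
      have := (summable_nat_add_iff 1).2 (Real.summable_one_div_nat_pow.2 one_lt_two)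
      simpa using this
    · intro j
      have hcont : Continuous fun x : ℝ =>
          (1 + (x : ℂ) * z) * Complex.exp (-((x : ℂ) * z)) - 1 := by fun_prop
      exact (hcont.tendsto (δ j)).comp (hδ j)
    · refine Eventually.of_forall fun n j => ?_
      refine (norm_one_add_mul_exp_neg_sub_one_le _).trans ?_
      have hn : ‖(γ (φ n) j : ℂ) * z‖ = γ (φ n) j * ‖z‖ := by
        rw [norm_mul, Complex.norm_real, Real.norm_eq_abs, abs_of_nonneg (hnn _ _)]
      rw [hn]
      have h1 : γ (φ n) j * ‖z‖ ≤ B * ‖z‖ * (1 / ((j : ℝ) + 1)) := by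
        have := mul_le_mul_of_nonneg_right (hdecay (φ n) j) (norm_nonneg z)
        calc _ ≤ _ := this
          _ = _ := by ring
      have h2 : γ (φ n) j * ‖z‖ ≤ B * ‖z‖ :=
        mul_le_mul_of_nonneg_right (hγB _ _) (norm_nonneg z)
      have h3 : 0 ≤ γ (φ n) j * ‖z‖ := mul_nonneg (hnn _ _) (norm_nonneg z)
      calc _ ≤ (B * ‖z‖ * (1 / ((j : ℝ) + 1))) ^ 2 * Real.exp (2 * (B * ‖z‖)) := by gcongr
        _ = _ := by ring
  have hγs : ∀ n, HasSum (γ n) (S n) := fun n =>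
    hasSum_sum_of_ne_finset_zero fun j hj => hzero n j (by simpa using hj)
  have hexp : Tendsto (fun n => Complex.exp ((S (φ n) : ℂ) * z)) atTop
      (𝓝 (Complex.exp ((T : ℂ) * z))) := by
    have hcont : Continuous fun x : ℝ => Complex.exp ((x : ℂ) * z) := by fun_prop
    exact (hcont.tendsto T).comp hT
  have hC : Tendsto (fun n => (((q (φ n + n₀)).eval 0 : ℝ) : ℂ)) atTop (𝓝 (c : ℂ)) :=
    (Complex.continuous_ofReal.tendsto c).comp (h0.comp hφ.tendsto_atTop)
  have hmain := (hC.mul hprod).mul hexp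
  refine (tendsto_nhds_unique (hmain.congr fun n => ?_)
    ((hg z).comp hφ.tendsto_atTop)).symm.trans ?_
  · rw [tprod_one_add_mul_exp_neg (hnn _) (hγs _).summable, (hγs _).tsum_eq]
    simp only [Function.comp_apply, hfac (φ n) z]
    rw [tprod_eq_prod (s := Finset.range (N (φ n)))
      fun j hj => by simp [hzero (φ n) j (by simpa using hj)]]
    rw [mul_assoc, mul_assoc, ← Complex.exp_add]
    simp
  · rw [tprod_one_add_mul_exp_neg hδnn hδs]
    have : Complex.exp (((T - ∑' j, δ j : ℝ) : ℂ) * z) =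
        Complex.exp (-(((∑' j, δ j : ℝ) : ℂ) * z)) * Complex.exp ((T : ℂ) * z) := by
      rw [← Complex.exp_add]
      congr 1
      rw [Complex.ofReal_sub]
      ring
    rw [this]
    ring

theorem tendsto_deriv_of_forall_norm_le {F : ℕ → ℂ → ℂ} {f : ℂ → ℂ}
    (hF : ∀ n, Differentiable ℂ (F n)) (hf : Differentiable ℂ f)
    (hlim : ∀ z, Tendsto (fun n => F n z) atTop (𝓝 (f z))) (z₀ : ℂ) {B : ℝ}
    (hB : ∀ n, ∀ z ∈ Metric.sphere z₀ 1, ‖F n z‖ ≤ B) :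
    Tendsto (fun n => deriv (F n) z₀) atTop (𝓝 (deriv f z₀)) := by
  have key : ∀ {h : ℂ → ℂ}, Differentiable ℂ h →
      deriv h z₀ = (2 * Real.pi * Complex.I)⁻¹ • ∮ z in C(z₀, 1), (1 / (z - z₀) ^ 2) • h z := by
    intro h hh
    rw [DifferentiableOn.deriv_eq_smul_circleIntegral one_pos hh.differentiableOn, smul_smul,
      inv_mul_cancel₀ Complex.two_pi_I_ne_zero, one_smul]
  rw [key hf]
  simp only [fun n => key (hF n)]
  refine Tendsto.const_smul ?_ _
  unfold circleIntegral
  have hne : ∀ θ : ℝ, circleMap z₀ 1 θ - z₀ ≠ 0 := fun θ => by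
    simp [circleMap]
  refine intervalIntegral.tendsto_integral_filter_of_dominated_convergence (fun _ => B) ?_ ?_ ?_ ?_
  · refine Eventually.of_forall fun n => Continuous.aestronglyMeasurable ?_
    have := (hF n).continuous
    simp only [deriv_circleMap]
    fun_prop (disch := exact fun θ => pow_ne_zero 2 (hne θ))
  · refine Eventually.of_forall fun n => Eventually.of_forall fun θ _ => ?_
    have := hB n (circleMap z₀ 1 θ) (circleMap_mem_sphere _ zero_le_one _)
    simpa [circleMap] using this
  · simp
  · exact Eventually.of_forall fun θ _ => ((hlim _).const_smul _).const_smul _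

theorem norm_one_add_le_exp_norm (x : ℂ) : ‖1 + x‖ ≤ Real.exp ‖x‖ :=
  (norm_add_le _ _).trans (by simpa [add_comm] using Real.add_one_le_exp ‖x‖)

/-- The derivative of a Laguerre entire function of the first kind which does not vanish at `0` is
again one, provided the derivative at `0` is positive. -/
theorem laguerreForm_deriv {f : ℂ → ℂ} (hf : Differentiable ℂ f) (hL : LaguerreForm f)
    (h0 : f 0 ≠ 0) {c : ℝ} (hc : 0 < c) (hd : deriv f 0 = c) : LaguerreForm (deriv f) := by
  obtain ⟨A, k, α, γ, hA, hα, hγ, hγs, hrep⟩ := hL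
  obtain rfl : k = 0 := by
    by_contra hk
    exact h0 (by rw [hrep 0, zero_pow hk]; simp)
  set p : ℕ → ℝ[X] := fun n => C A * ((∏ _j ∈ Finset.range n, (1 + C (α / n) * X)) *
    ∏ j ∈ Finset.range n, (1 + C (γ j) * X)) with hp
  have hps : ∀ n, (p n).Splits := fun n =>
    ((Splits.prod fun _ _ => splits_one_add_C_mul_X _).mul
      (Splits.prod fun _ _ => splits_one_add_C_mul_X _)).C_mul A
  have hpc : ∀ n i, 0 ≤ (p n).coeff i := by
    intro n i
    rw [hp, coeff_C_mul]
    exact mul_nonneg hA.le (coeff_mul_nonneg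
      (coeff_prod_nonneg _ fun _ _ => coeff_one_add_C_mul_X_nonneg (by positivity))
      (coeff_prod_nonneg _ fun _ _ => coeff_one_add_C_mul_X_nonneg (hγ _)) i)
  have hval : ∀ n (z : ℂ), aeval z (p n) = (A : ℂ) * ((1 + (α : ℂ) * z / n) ^ n *
      ∏ j ∈ Finset.range n, (1 + (γ j : ℂ) * z)) := by
    intro n z
    simp only [hp, map_mul, map_prod, map_add, map_one, map_pow, aeval_C, aeval_X,
      Finset.prod_const, Finset.card_range, Complex.coe_algebraMap, Complex.ofReal_div,
      Complex.ofReal_natCast, div_mul_eq_mul_div]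
  have hderiv : ∀ n (z : ℂ), deriv (fun w => aeval w (p n)) z = aeval z (derivative (p n)) :=
    fun n z => ((p n).hasDerivAt_aeval z).deriv
  have hlim : ∀ z, Tendsto (fun n => aeval z (derivative (p n))) atTop (𝓝 (deriv f z)) := by
    intro z₀
    simp only [← hderiv]
    refine tendsto_deriv_of_forall_norm_le (fun n => (p n).differentiable_aeval) hf (fun z => ?_) z₀
      (B := A * (Real.exp (α * (‖z₀‖ + 1)) * Real.exp ((∑' j, γ j) * (‖z₀‖ + 1)))) ?_
    · simp only [hval, hrep z, pow_zero, mul_one, mul_assoc]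
      refine ((Complex.tendsto_one_add_div_pow_exp _).mul (HasProd.tendsto_prod_nat ?_)).const_mul _
      refine (multipliable_one_add_of_summable ?_).hasProd
      simpa [abs_of_nonneg (hγ _)] using hγs.mul_right ‖z‖
    · intro n z hz
      have hz' : ‖z‖ ≤ ‖z₀‖ + 1 := by
        have := norm_add_le z₀ (z - z₀)
        rw [mem_sphere_iff_norm.1 hz] at this
        simpa using this
      rw [hval, norm_mul, norm_mul, Complex.norm_real, Real.norm_eq_abs, abs_of_pos hA]
      gcongr
      · rcases Nat.eq_zero_or_pos n with rfl | hn
        · simpa using by positivity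
        rw [norm_pow]
        calc ‖1 + (α : ℂ) * z / n‖ ^ n ≤ Real.exp ‖(α : ℂ) * z / n‖ ^ n := by
              gcongr; exact norm_one_add_le_exp_norm _
          _ = Real.exp (α * ‖z‖) := by
              rw [← Real.exp_nat_mul]
              congr 1
              simp only [norm_div, norm_mul, Complex.norm_real, Real.norm_eq_abs,
                abs_of_nonneg hα, Complex.norm_natCast]
              field_simp
          _ ≤ _ := by gcongr
      · calc ‖∏ j ∈ Finset.range n, (1 + (γ j : ℂ) * z)‖
            ≤ ∏ j ∈ Finset.range n, Real.exp (γ j * ‖z‖) := by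
              rw [norm_prod]
              refine Finset.prod_le_prod (fun _ _ => norm_nonneg _) fun j _ => ?_
              refine (norm_one_add_le_exp_norm _).trans_eq ?_
              rw [norm_mul, Complex.norm_real, Real.norm_eq_abs, abs_of_nonneg (hγ j)]
          _ = Real.exp ((∑ j ∈ Finset.range n, γ j) * ‖z‖) := by
              rw [← Real.exp_sum, Finset.sum_mul]
          _ ≤ _ := by
              have := hγs.sum_le_tsum (Finset.range n) fun j _ => hγ j
              have h2 : 0 ≤ ∑' j, γ j := tsum_nonneg hγ
              gcongr
  refine laguerreForm_of_tendsto (fun n => (hps n).derivative_of_real)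
    (fun n => coeff_derivative_nonneg (hpc n)) hc ?_ hlim
  have h1 := (Complex.continuous_re.tendsto _).comp (hlim 0)
  rw [hd] at h1
  refine h1.congr fun n => ?_
  have := aeval_algebraMap_apply ℂ (0 : ℝ) (derivative (p n))
  simp only [map_zero] at this
  simp [this]

/-- The coefficient of `ζⁿ` in `wD D ζ r`. -/
def wCoeff (D n : ℕ) (r : ℝ) : ℝ :=
  r ^ ((D : ℝ) / 2 + n - 1) / (4 ^ n * n.factorial * Real.Gamma ((D : ℝ) / 2 + n))

theorem wD_eq_tsum (D : ℕ) (ζ : ℂ) (r : ℝ) : wD D ζ r = ∑' n, ζ ^ n * (wCoeff D n r : ℂ) := rfl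

theorem Gamma_le_two_pow_mul_Gamma_add {s : ℝ} (hs : 1 / 2 ≤ s) (n : ℕ) :
    Real.Gamma s ≤ 2 ^ n * Real.Gamma (s + n) := by
  induction n with
  | zero => simp
  | succ n ih =>
    have hsn : 0 < s + n := by positivity
    have hG := Real.Gamma_pos_of_pos hsn
    have h1 : (1 : ℝ) / 2 ≤ s + n := hs.trans (le_add_of_nonneg_right n.cast_nonneg)
    rw [Nat.cast_succ, ← add_assoc, Real.Gamma_add_one hsn.ne']
    calc Real.Gamma s ≤ 2 ^ n * Real.Gamma (s + n) := ih
      _ = 2 ^ (n + 1) * (1 / 2 * Real.Gamma (s + n)) := by ring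
      _ ≤ _ := by gcongr

theorem half_le_natCast_div_two {D : ℕ} (hD : 0 < D) : (1 : ℝ) / 2 ≤ (D : ℝ) / 2 := by
  have : (1 : ℝ) ≤ D := by exact_mod_cast hD
  linarith

theorem wCoeff_pos {D : ℕ} (hD : 0 < D) {r : ℝ} (hr : 0 < r) (n : ℕ) : 0 < wCoeff D n r := by
  have hG : 0 < Real.Gamma ((D : ℝ) / 2 + n) := Real.Gamma_pos_of_pos (by positivity)
  unfold wCoeff
  positivity

theorem wCoeff_zero (D : ℕ) (r : ℝ) :
    wCoeff D 0 r = r ^ ((D : ℝ) / 2 - 1) / Real.Gamma ((D : ℝ) / 2) := by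
  simp [wCoeff]

theorem wCoeff_le {D : ℕ} (hD : 0 < D) {r : ℝ} (hr : 0 < r) (n : ℕ) :
    wCoeff D n r ≤ wCoeff D 0 r * ((r / 2) ^ n / n.factorial) := by
  have hG : 0 < Real.Gamma ((D : ℝ) / 2) := Real.Gamma_pos_of_pos (by positivity)
  have hGn : 0 < Real.Gamma ((D : ℝ) / 2 + n) := Real.Gamma_pos_of_pos (by positivity)
  have h1 := Gamma_le_two_pow_mul_Gamma_add (half_le_natCast_div_two hD) n
  have h2 : r ^ ((D : ℝ) / 2 + n - 1) = r ^ ((D : ℝ) / 2 - 1) * r ^ n := by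
    rw [← Real.rpow_add_natCast hr.ne']
    congr 1
    ring
  have h4 : (4 : ℝ) ^ n = 2 ^ n * 2 ^ n := by rw [← mul_pow]; norm_num
  rw [wCoeff_zero, wCoeff, h2, div_pow, div_div, div_mul_div_comm]
  refine div_le_div_of_nonneg_left (by positivity) (by positivity) ?_
  calc _ = 2 ^ n * (n.factorial : ℝ) * Real.Gamma ((D : ℝ) / 2) := by ring
    _ ≤ 2 ^ n * (n.factorial : ℝ) * (2 ^ n * Real.Gamma ((D : ℝ) / 2 + n)) := by gcongr
    _ = _ := by rw [h4]; ring

theorem wCoeff_succ {D : ℕ} (hD : 0 < D) (n : ℕ) (r : ℝ) :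
    (n + 1 : ℝ) * wCoeff D (n + 1) r = wCoeff (D + 2) n r / 4 := by
  have hGn : Real.Gamma ((D : ℝ) / 2 + n + 1) ≠ 0 :=
    (Real.Gamma_pos_of_pos (by positivity)).ne'
  have e1 : (D : ℝ) / 2 + ((n : ℝ) + 1) = (D : ℝ) / 2 + n + 1 := by ring
  have e2 : ((D : ℝ) + 2) / 2 + n = (D : ℝ) / 2 + n + 1 := by ring
  simp only [wCoeff, Nat.cast_add, Nat.cast_one, Nat.cast_ofNat, e1, e2, Nat.factorial_succ,
    Nat.cast_mul]
  field_simp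
  ring

theorem norm_pow_mul_wCoeff_le {D : ℕ} (hD : 0 < D) {r : ℝ} (hr : 0 < r) {ζ : ℂ} {R : ℝ}
    (hζ : ‖ζ‖ ≤ R) (n : ℕ) :
    ‖ζ ^ n * (wCoeff D n r : ℂ)‖ ≤ wCoeff D 0 r * ((R * r / 2) ^ n / n.factorial) := by
  rw [norm_mul, norm_pow, Complex.norm_real, Real.norm_eq_abs, abs_of_pos (wCoeff_pos hD hr n)]
  have h0 := wCoeff_pos hD hr 0
  have hR := (norm_nonneg ζ).trans hζ
  calc ‖ζ‖ ^ n * wCoeff D n r ≤ R ^ n * (wCoeff D 0 r * ((r / 2) ^ n / n.factorial)) := by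
        gcongr
        · exact (wCoeff_pos hD hr n).le
        · exact wCoeff_le hD hr n
    _ = _ := by rw [mul_div_assoc, mul_pow]; ring

theorem hasSum_wCoeff_bound (D : ℕ) (r R : ℝ) :
    HasSum (fun n : ℕ => wCoeff D 0 r * ((R * r / 2) ^ n / n.factorial))
      (wCoeff D 0 r * Real.exp (R * r / 2)) := by
  rw [Real.exp_eq_exp_ℝ]
  exact (NormedSpace.expSeries_div_hasSum_exp (R * r / 2)).mul_left _

theorem summable_wD {D : ℕ} (hD : 0 < D) {r : ℝ} (hr : 0 < r) (ζ : ℂ) :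
    Summable fun n => ζ ^ n * (wCoeff D n r : ℂ) :=
  .of_norm_bounded (hasSum_wCoeff_bound D r ‖ζ‖).summable (norm_pow_mul_wCoeff_le hD hr le_rfl)

theorem norm_wD_le {D : ℕ} (hD : 0 < D) {r : ℝ} (hr : 0 < r) {ζ : ℂ} {R : ℝ} (hζ : ‖ζ‖ ≤ R) :
    ‖wD D ζ r‖ ≤ wCoeff D 0 r * Real.exp (R * r / 2) :=
  tsum_of_norm_bounded (hasSum_wCoeff_bound D r R) (norm_pow_mul_wCoeff_le hD hr hζ)

theorem wD_zero (D : ℕ) (r : ℝ) : wD D 0 r = (wCoeff D 0 r : ℂ) := by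
  rw [wD_eq_tsum, tsum_eq_single 0 fun n hn => by simp [hn]]
  simp

theorem wCoeff_zero_le_norm_wD_one {D : ℕ} (hD : 0 < D) {r : ℝ} (hr : 0 < r) :
    wCoeff D 0 r ≤ ‖wD D 1 r‖ := by
  have hs := summable_wD hD hr 1
  simp only [one_pow, one_mul, Complex.summable_ofReal] at hs
  have h1 := hs.le_tsum 0 fun n _ => (wCoeff_pos hD hr n).le
  simp only [wD_eq_tsum, one_pow, one_mul, ← Complex.ofReal_tsum, Complex.norm_real]
  exact h1.trans (le_abs_self _)

theorem hasDerivAt_wD {D : ℕ} (hD : 0 < D) {r : ℝ} (hr : 0 < r) (ζ : ℂ) :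
    HasDerivAt (fun z => wD D z r) (wD (D + 2) ζ r / 4) ζ := by
  have hterm : ∀ (n : ℕ) (z : ℂ), ((n + 1 : ℕ) : ℂ) * z ^ n * (wCoeff D (n + 1) r : ℂ) =
      z ^ n * (wCoeff (D + 2) n r : ℂ) / 4 := by
    intro n z
    have := congrArg (fun x : ℝ => (x : ℂ)) (wCoeff_succ hD n r)
    push_cast at this ⊢
    linear_combination z ^ n * this
  set R := ‖ζ‖ + 1
  have hζ : ζ ∈ Metric.ball (0 : ℂ) R := by simp [R]
  have hsum : Summable fun n : ℕ => (n : ℂ) * ζ ^ (n - 1) * (wCoeff D n r : ℂ) := by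
    refine (summable_nat_add_iff 1).1 ?_
    simp only [Nat.add_sub_cancel, hterm]
    exact (summable_wD (Nat.add_pos_left hD 2) hr ζ).div_const 4
  have h := hasDerivAt_tsum_of_isPreconnected (𝕜 := ℂ) (g := fun (n : ℕ) z => z ^ n * (wCoeff D n r : ℂ))
    (g' := fun (n : ℕ) z => (n : ℂ) * z ^ (n - 1) * (wCoeff D n r : ℂ))
    (u := fun n : ℕ => ‖(n : ℂ) * (R : ℂ) ^ (n - 1) * (wCoeff D n r : ℂ)‖) (y₀ := ζ) (y := ζ)
    ?_ Metric.isOpen_ball (convex_ball (0 : ℂ) R).isPreconnected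
    (fun n z _ => (hasDerivAt_pow n z).mul_const _) ?_ hζ (summable_wD hD hr ζ) hζ
  · refine h.congr_deriv ?_
    rw [hsum.tsum_eq_zero_add]
    simp only [Nat.add_sub_cancel, hterm]
    simp [wD_eq_tsum, tsum_div_const]
  · refine (summable_nat_add_iff 1).1 ?_
    simp only [Nat.add_sub_cancel, hterm]
    exact ((summable_wD (Nat.add_pos_left hD 2) hr R).div_const 4).norm
  · intro n z hz
    have hz' : ‖z‖ ≤ R := by simpa using (mem_ball_zero_iff.1 hz).le
    have hR : ‖(R : ℂ)‖ = R := by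
      rw [Complex.norm_real, Real.norm_eq_abs, abs_of_nonneg (by positivity)]
    simp only [norm_mul, norm_pow, hR]
    gcongr

theorem measurable_wCoeff (D n : ℕ) : Measurable (wCoeff D n) := by
  unfold wCoeff
  fun_prop

theorem aestronglyMeasurable_wD {D : ℕ} (hD : 0 < D) (ζ : ℂ) :
    AEStronglyMeasurable (fun r => wD D ζ r) (volume.restrict (Set.Ioi (0 : ℝ))) := by
  refine aestronglyMeasurable_of_tendsto_ae atTop
    (f := fun N r => ∑ n ∈ Finset.range N, ζ ^ n * (wCoeff D n r : ℂ)) (fun N => ?_) ?_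
  · refine Measurable.aestronglyMeasurable ?_
    have := measurable_wCoeff D
    fun_prop
  · filter_upwards [ae_restrict_mem measurableSet_Ioi] with r hr
    exact (summable_wD hD hr ζ).hasSum.tendsto_sum_nat

theorem LaguerreForm.apply_one_ne_zero {h : ℂ → ℂ} (hL : LaguerreForm h) : h 1 ≠ 0 := by
  obtain ⟨A, k, α, γ, hA, -, hγ, hγs, hrep⟩ := hL
  rw [hrep 1]
  refine mul_ne_zero (mul_ne_zero (mul_ne_zero (by exact_mod_cast hA.ne') (by simp))
    (Complex.exp_ne_zero _)) (tprod_one_add_ne_zero_of_summable (fun j => ?_) ?_)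
  · rw [mul_one]
    exact_mod_cast (add_pos_of_pos_of_nonneg one_pos (hγ j)).ne'
  · simpa [abs_of_nonneg (hγ _)] using hγs

theorem LaguerreForm.const_mul {h : ℂ → ℂ} (hL : LaguerreForm h) {c : ℝ} (hc : 0 < c) :
    LaguerreForm fun z => (c : ℂ) * h z := by
  obtain ⟨A, k, α, γ, hA, hα, hγ, hγs, hrep⟩ := hL
  refine ⟨c * A, k, α, γ, mul_pos hc hA, hα, hγ, hγs, fun z => ?_⟩
  simp only [hrep z]
  push_cast
  ring

/-- All exponential moments of `τ` against the leading coefficient of the kernel are finite. -/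
def KernelIntegrable (τ : ℝ → ℝ) (D : ℕ) : Prop :=
  ∀ a : ℝ, IntegrableOn (fun r => wCoeff D 0 r * Real.exp (a * r) * τ r) (Set.Ioi (0 : ℝ))

section Vtau

variable {D : ℕ} {τ : ℝ → ℝ}

theorem KernelIntegrable.add_two (hD : 0 < D) (hτm : Measurable τ) (h : KernelIntegrable τ D) :
    KernelIntegrable τ (D + 2) := by
  intro a
  refine Integrable.mono' ((h (a + 1)).norm.const_mul 2) ?_ ?_
  · have := measurable_wCoeff (D + 2) 0
    exact Measurable.aestronglyMeasurable (by fun_prop)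
  · filter_upwards [ae_restrict_mem measurableSet_Ioi] with r hr
    have hr : 0 < r := hr
    have h0 := wCoeff_pos hD hr 0
    have h2 := wCoeff_pos (Nat.add_pos_left hD 2) hr 0
    have h1 : wCoeff (D + 2) 0 r ≤ 2 * (wCoeff D 0 r * Real.exp r) := by
      have e1 := wCoeff_succ hD 0 r
      have e2 := wCoeff_le hD hr 1
      have e3 : r ≤ Real.exp r := by linarith [Real.add_one_le_exp r]
      simp only [Nat.cast_zero, zero_add, one_mul, pow_one, Nat.factorial_one, Nat.cast_one,
        div_one] at e1 e2
      nlinarith [mul_le_mul_of_nonneg_left e3 h0.le]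
    simp only [norm_mul, Real.norm_eq_abs, abs_of_pos h0, abs_of_pos h2, Real.abs_exp, add_mul,
      Real.exp_add, one_mul]
    calc _ ≤ 2 * (wCoeff D 0 r * Real.exp r) * Real.exp (a * r) * |τ r| := by gcongr
      _ = _ := by ring

theorem kernelIntegrable_of_laguerreForm (hD : 0 < D) (hτm : Measurable τ)
    (hτint : ∀ a : ℝ, 0 < a →
      IntegrableOn (fun r => Real.exp (a * r) * τ r) (Set.Ioi (0 : ℝ)))
    (hL : LaguerreForm (vtau τ D)) : KernelIntegrable τ D := by
  have hint : IntegrableOn (fun r => wD D 1 r * ((τ r : ℝ) : ℂ)) (Set.Ioi 0) := by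
    by_contra hni
    exact hL.apply_one_ne_zero (by rw [vtau, integral_undef hni, mul_zero])
  intro a
  set G := Real.Gamma ((D : ℝ) / 2)
  have hG : 0 < G := Real.Gamma_pos_of_pos (by positivity)
  refine Integrable.mono' ((hint.norm.const_mul (Real.exp |a|)).add
    ((hτint (|a| + D / 2) (by positivity)).norm.const_mul G⁻¹)) ?_ ?_
  · have := measurable_wCoeff D 0
    exact Measurable.aestronglyMeasurable (by fun_prop)
  · filter_upwards [ae_restrict_mem measurableSet_Ioi] with r hr
    have hr : 0 < r := hr
    have h0 := wCoeff_pos hD hr 0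
    simp only [norm_mul, Real.norm_eq_abs, abs_of_pos h0, Real.abs_exp, Pi.add_apply,
      Complex.norm_real]
    have ha : a * r ≤ |a| * r := mul_le_mul_of_nonneg_right (le_abs_self a) hr.le
    rcases le_total r 1 with h1 | h1
    · have h3 : a * r ≤ |a| := ha.trans (mul_le_of_le_one_right (abs_nonneg a) h1)
      have h4 := wCoeff_zero_le_norm_wD_one hD hr
      calc _ ≤ ‖wD D 1 r‖ * Real.exp |a| * |τ r| := by gcongr
        _ = Real.exp |a| * (‖wD D 1 r‖ * |τ r|) := by ring
        _ ≤ _ := le_add_of_nonneg_right (by positivity)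
    · have h3 : r ^ ((D : ℝ) / 2 - 1) ≤ Real.exp (D / 2 * r) := by
        calc r ^ ((D : ℝ) / 2 - 1) ≤ r ^ ((D : ℝ) / 2) :=
              Real.rpow_le_rpow_of_exponent_le h1 (by linarith)
          _ ≤ (Real.exp r) ^ ((D : ℝ) / 2) :=
              Real.rpow_le_rpow hr.le (by linarith [Real.add_one_le_exp r]) (by positivity)
          _ = _ := by rw [← Real.exp_mul, mul_comm]
      rw [wCoeff_zero]
      calc _ ≤ Real.exp (D / 2 * r) / G * Real.exp (|a| * r) * |τ r| := by gcongr
        _ = G⁻¹ * (Real.exp ((|a| + D / 2) * r) * |τ r|) := by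
            rw [add_mul, Real.exp_add]; ring
        _ ≤ _ := le_add_of_nonneg_left (by positivity)

theorem aestronglyMeasurable_wD_mul (hD : 0 < D) (hτm : Measurable τ) (ζ : ℂ) :
    AEStronglyMeasurable (fun r => wD D ζ r * ((τ r : ℝ) : ℂ))
      (volume.restrict (Set.Ioi (0 : ℝ))) :=
  (aestronglyMeasurable_wD hD ζ).mul
    (Complex.measurable_ofReal.comp hτm).aestronglyMeasurable

theorem norm_wD_mul_le (hD : 0 < D) {r : ℝ} (hr : 0 < r) {ζ : ℂ} {R : ℝ} (hζ : ‖ζ‖ ≤ R) :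
    ‖wD D ζ r * ((τ r : ℝ) : ℂ)‖ ≤ ‖wCoeff D 0 r * Real.exp (R / 2 * r) * τ r‖ := by
  have h0 := wCoeff_pos hD hr 0
  simp only [norm_mul, Complex.norm_real, Real.norm_eq_abs, abs_of_pos h0, Real.abs_exp]
  have := norm_wD_le hD hr hζ
  rw [div_mul_eq_mul_div]
  gcongr

theorem integrable_wD_mul (hD : 0 < D) (hτm : Measurable τ) (h : KernelIntegrable τ D) (ζ : ℂ) :
    IntegrableOn (fun r => wD D ζ r * ((τ r : ℝ) : ℂ)) (Set.Ioi (0 : ℝ)) := by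
  refine Integrable.mono' (h (‖ζ‖ / 2)).norm (aestronglyMeasurable_wD_mul hD hτm ζ) ?_
  filter_upwards [ae_restrict_mem measurableSet_Ioi] with r hr
  exact norm_wD_mul_le hD hr le_rfl

theorem hasDerivAt_vtau (hD : 0 < D) (hτm : Measurable τ) (h : KernelIntegrable τ D) (ζ : ℂ) :
    HasDerivAt (vtau τ D) (vtau τ (D + 2) ζ / (4 * Real.pi)) ζ := by
  have hD2 : 0 < D + 2 := Nat.add_pos_left hD 2
  have key := (hasDerivAt_integral_of_dominated_loc_of_deriv_le
    (μ := volume.restrict (Set.Ioi (0 : ℝ))) (𝕜 := ℂ)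
    (F := fun z r => wD D z r * ((τ r : ℝ) : ℂ))
    (F' := fun z r => 1 / 4 * (wD (D + 2) z r * ((τ r : ℝ) : ℂ)))
    (bound := fun r => ‖wCoeff (D + 2) 0 r * Real.exp ((‖ζ‖ + 1) / 2 * r) * τ r‖)
    (Metric.ball_mem_nhds ζ one_pos)
    (Eventually.of_forall fun z => aestronglyMeasurable_wD_mul hD hτm z)
    (integrable_wD_mul hD hτm h ζ)
    ((aestronglyMeasurable_wD_mul hD2 hτm ζ).const_mul _) ?_ (h.add_two hD hτm _).norm ?_).2
  · have := key.const_mul ((Real.pi ^ ((D : ℝ) / 2) : ℝ) : ℂ)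
    refine this.congr_deriv ?_
    have hpi : (Real.pi : ℂ) ≠ 0 := by exact_mod_cast Real.pi_ne_zero
    have e : Real.pi ^ (((D + 2 : ℕ) : ℝ) / 2) = Real.pi ^ ((D : ℝ) / 2) * Real.pi := by
      rw [← Real.rpow_add_one Real.pi_ne_zero]
      congr 1
      push_cast
      ring
    rw [vtau, e, integral_const_mul, Complex.ofReal_mul]
    field_simp
  · filter_upwards [ae_restrict_mem measurableSet_Ioi] with r hr z hz
    have hz' : ‖z‖ ≤ ‖ζ‖ + 1 := by
      have := norm_add_le ζ (z - ζ)
      rw [add_sub_cancel] at this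
      linarith [mem_ball_iff_norm.1 hz]
    rw [norm_mul]
    refine (mul_le_of_le_one_left (norm_nonneg _) (by norm_num)).trans ?_
    exact norm_wD_mul_le hD2 hr hz'
  · filter_upwards [ae_restrict_mem measurableSet_Ioi] with r hr z _ using
      ((hasDerivAt_wD hD hr z).mul_const ((τ r : ℝ) : ℂ)).congr_deriv (by ring)

theorem exists_pos_vtau_zero_eq (hD : 0 < D) (hτnn : ∀ r, 0 ≤ r → 0 ≤ τ r)
    (h : KernelIntegrable τ D) (hτ : ¬ τ =ᵐ[volume.restrict (Set.Ioi (0 : ℝ))] 0) :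
    ∃ c : ℝ, 0 < c ∧ vtau τ D 0 = c := by
  refine ⟨Real.pi ^ ((D : ℝ) / 2) * ∫ r in Set.Ioi (0 : ℝ), wCoeff D 0 r * τ r,
    mul_pos (Real.rpow_pos_of_pos Real.pi_pos _) ?_, ?_⟩
  · have hnn : 0 ≤ᵐ[volume.restrict (Set.Ioi (0 : ℝ))] fun r => wCoeff D 0 r * τ r := by
      filter_upwards [ae_restrict_mem measurableSet_Ioi] with r hr
      exact mul_nonneg (wCoeff_pos hD hr 0).le (hτnn r (le_of_lt hr))
    refine (integral_nonneg_of_ae hnn).lt_of_ne' fun hzero => hτ ?_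
    have hi : Integrable (fun r => wCoeff D 0 r * τ r) (volume.restrict (Set.Ioi (0 : ℝ))) := by
      simpa [IntegrableOn] using h 0
    filter_upwards [(integral_eq_zero_iff_of_nonneg_ae hnn hi).1 hzero,
      ae_restrict_mem measurableSet_Ioi] with r hr hr'
    exact (mul_eq_zero.1 hr).resolve_left (wCoeff_pos hD hr' 0).ne'
  · rw [vtau, Complex.ofReal_mul, ← integral_complex_ofReal]
    simp only [wD_zero, Complex.ofReal_mul]

theorem not_ae_zero_of_laguerreForm (hL : LaguerreForm (vtau τ D)) :
    ¬ τ =ᵐ[volume.restrict (Set.Ioi (0 : ℝ))] 0 := by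
  intro hτ
  refine hL.apply_one_ne_zero ?_
  rw [vtau, integral_eq_zero_of_ae, mul_zero]
  filter_upwards [hτ] with r hr
  simp [hr]

theorem laguerreForm_vtau_add_two (hD : 0 < D) (hτm : Measurable τ)
    (hτnn : ∀ r, 0 ≤ r → 0 ≤ τ r)
    (hτint : ∀ a : ℝ, 0 < a →
      IntegrableOn (fun r => Real.exp (a * r) * τ r) (Set.Ioi (0 : ℝ)))
    (hL : LaguerreForm (vtau τ D)) : LaguerreForm (vtau τ (D + 2)) := by
  have hK := kernelIntegrable_of_laguerreForm hD hτm hτint hL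
  have hτ := not_ae_zero_of_laguerreForm hL
  obtain ⟨c, hc, hvc⟩ := exists_pos_vtau_zero_eq hD hτnn hK hτ
  obtain ⟨d, hd, hvd⟩ :=
    exists_pos_vtau_zero_eq (Nat.add_pos_left hD 2) hτnn (hK.add_two hD hτm) hτ
  have hder := fun ζ => (hasDerivAt_vtau hD hτm hK ζ).deriv
  have hpi : 0 < 4 * Real.pi := by positivity
  have key := laguerreForm_deriv (c := d / (4 * Real.pi))
    (fun ζ => (hasDerivAt_vtau hD hτm hK ζ).differentiableAt) hL
    (by rw [hvc]; exact_mod_cast hc.ne') (by positivity) (by rw [hder, hvd]; push_cast; rfl)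
  convert key.const_mul hpi using 1
  funext ζ
  have : (Real.pi : ℂ) ≠ 0 := by exact_mod_cast Real.pi_ne_zero
  rw [hder ζ]
  push_cast
  field_simp

end Vtau

/-- **Lemma 1:** if `v_τ(·, D)` is a Laguerre entire function of the first kind, then so
is `v_τ(·, D + 2m)` for every `m ∈ ℕ₀`. -/
theorem vtau_laguerre_step (D : ℕ) (hD : 0 < D) (τ : ℝ → ℝ)
    (hτm : Measurable τ) (hτnn : ∀ r, 0 ≤ r → 0 ≤ τ r)
    (hτint : ∀ a : ℝ, 0 < a →
      IntegrableOn (fun r => Real.exp (a * r) * τ r) (Set.Ioi (0 : ℝ)))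
    (hL : LaguerreForm (vtau τ D)) :
    ∀ m : ℕ, LaguerreForm (vtau τ (D + 2 * m)) := by
  intro m
  induction m with
  | zero => exact hL
  | succ m ih =>
    rw [show D + 2 * (m + 1) = D + 2 * m + 2 by ring]
    exact laguerreForm_vtau_add_two (Nat.add_pos_left hD _) hτm hτnn hτint ih
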